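/- Let E be a finite-dimensional real vector space and C ⊆ E a nonempty closed convex subset with 0 ∉ C whose recession cone lim(C) := {x ∈ E : C + x ⊆ C} is pointed, i.e., lim(C) ∩ (−lim(C)) = {0}. Then the closed convex cone cone(C) := closure({t·c : t ≥ 0, c ∈ C}) is pointed: cone(C) ∩ (−cone(C)) = {0}. -/

import Mathlib

open Filter Topology in
/-- A point of the closed cone generated by a closed convex set avoiding the origin is either a
positive multiple of a point of the set or a recession direction of the set. -/
theorem pos_smul_or_recession_of_mem_closure_cone {E : Type*} [NormedAddCommGroup E]
    [NormedSpace ℝ E] {C : Set E} (hcl : IsClosed C) (hconv : Convex ℝ C) (h0 : (0 : E) ∉ C)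
    {y : E} (hy : y ∈ closure {y : E | ∃ t : ℝ, 0 ≤ t ∧ ∃ c ∈ C, y = t • c}) :
    (∃ t : ℝ, 0 < t ∧ ∃ c ∈ C, y = t • c) ∨ ∀ c ∈ C, c + y ∈ C := by
  obtain ⟨u, hu, hlim⟩ := mem_closure_iff_seq_limit.1 hy
  choose t ht c hc huc using hu
  obtain ⟨ε, hε, hball⟩ := Metric.isOpen_iff.1 hcl.isOpen_compl 0 h0
  have hnorm : ∀ n, ε ≤ ‖c n‖ := fun n => by
    by_contra! h
    exact hball (by simpa using h) (hc n)
  obtain ⟨M, hM⟩ := hlim.norm.bddAbove_range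
  have htM : ∀ n, t n ∈ Set.Icc 0 (M / ε) := fun n => by
    refine ⟨ht n, (le_div_iff₀ hε).2 ?_⟩
    calc t n * ε ≤ t n * ‖c n‖ := mul_le_mul_of_nonneg_left (hnorm n) (ht n)
      _ = ‖u n‖ := by rw [huc, norm_smul, Real.norm_of_nonneg (ht n)]
      _ ≤ M := hM ⟨n, rfl⟩
  obtain ⟨a, ha, φ, hφ, hta⟩ := isCompact_Icc.tendsto_subseq htM
  have hlim' : Tendsto (u ∘ φ) atTop (𝓝 y) := hlim.comp hφ.tendsto_atTop
  rcases ha.1.eq_or_lt with rfl | hapos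
  · right
    intro d hd
    have hconvlim : Tendsto (fun n => (1 - t (φ n)) • d + u (φ n)) atTop (𝓝 (d + y)) := by
      simpa using ((hta.const_sub 1).smul_const d).add hlim'
    refine hcl.mem_of_tendsto hconvlim ?_
    filter_upwards [hta.eventually_le_const one_pos] with n hn
    rw [huc]
    exact hconv hd (hc _) (sub_nonneg.2 hn) (ht _) (by ring)
  · left
    refine ⟨a, hapos, a⁻¹ • y, ?_, (smul_inv_smul₀ hapos.ne' y).symm⟩
    refine hcl.mem_of_tendsto ((hta.inv₀ hapos.ne').smul hlim') ?_
    filter_upwards [hta.eventually_const_lt hapos] with n hn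
    have hn' : t (φ n) ≠ 0 := ne_of_gt hn
    simpa [huc, inv_smul_smul₀ hn'] using hc (φ n)

/-- A convex set with two points admitting a vanishing nontrivial nonnegative combination
contains the origin. -/
theorem Convex.zero_mem_of_smul_add_smul_eq_zero {E : Type*} [AddCommGroup E] [Module ℝ E] {C : Set E}
    (hconv : Convex ℝ C) {c d : E} (hc : c ∈ C) (hd : d ∈ C) {s t : ℝ} (hs : 0 < s) (ht : 0 ≤ t)
    (h : s • c + t • d = 0) : (0 : E) ∈ C := by
  have hst : 0 < s + t := by positivity
  have := hconv hc hd (a := s / (s + t)) (b := t / (s + t)) (by positivity) (by positivity)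
    (by field_simp)
  rwa [div_eq_inv_mul, div_eq_inv_mul, mul_smul, mul_smul, ← smul_add, h, smul_zero] at this

/-- If a convex set is stable under translation by a negative multiple of one of its points,
then it contains the origin. -/
theorem Convex.zero_mem_of_neg_smul_recession {E : Type*} [AddCommGroup E] [Module ℝ E] {C : Set E}
    (hconv : Convex ℝ C) {c : E} (hc : c ∈ C) {s : ℝ} (hs : 0 < s)
    (h : ∀ d ∈ C, d + -(s • c) ∈ C) : (0 : E) ∈ C := by
  have hiter : ∀ n : ℕ, (1 - n * s) • c ∈ C := fun n => by
    induction n with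
    | zero => simpa using hc
    | succ n ih =>
      convert h _ ih using 1
      push_cast
      module
  obtain ⟨n, hn⟩ := exists_nat_gt (1 / s)
  have hn' : 1 < n * s := (div_lt_iff₀ hs).1 hn
  exact hconv.zero_mem_of_smul_add_smul_eq_zero hc (hiter n) (sub_pos.2 hn') zero_le_one (by module)

/-- If `C` is a nonempty closed convex subset of a finite-dimensional real vector space
with `0 ∉ C` and pointed recession cone, then the closed convex cone generated by `C`
is pointed. -/
theorem cone_of_pointed_recession (E : Type) [NormedAddCommGroup E] [NormedSpace ℝ E]
    [FiniteDimensional ℝ E]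
    (C : Set E) (hne : C.Nonempty) (hcl : IsClosed C) (hconv : Convex ℝ C)
    (h0 : (0 : E) ∉ C)
    (hrec : {x : E | ∀ c ∈ C, c + x ∈ C} ∩ -{x : E | ∀ c ∈ C, c + x ∈ C} = {0}) :
    closure {y : E | ∃ t : ℝ, 0 ≤ t ∧ ∃ c ∈ C, y = t • c} ∩
      -closure {y : E | ∃ t : ℝ, 0 ≤ t ∧ ∃ c ∈ C, y = t • c} = {0} := by
  apply Set.Subset.antisymm
  · rintro x ⟨hx, hnx⟩
    rcases pos_smul_or_recession_of_mem_closure_cone hcl hconv h0 hx with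
      ⟨s, hs, c, hc, hxc⟩ | hx'
    · rcases pos_smul_or_recession_of_mem_closure_cone hcl hconv h0 (Set.mem_neg.1 hnx) with
        ⟨t, ht, d, hd, hxd⟩ | hnx'
      · exact absurd (hconv.zero_mem_of_smul_add_smul_eq_zero hc hd hs ht.le
          (by rw [← hxc, ← hxd, add_neg_cancel])) h0
      · exact absurd (hconv.zero_mem_of_neg_smul_recession hc hs (hxc ▸ hnx')) h0
    · rcases pos_smul_or_recession_of_mem_closure_cone hcl hconv h0 (Set.mem_neg.1 hnx) with
        ⟨t, ht, d, hd, hxd⟩ | hnx'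
      · refine absurd (hconv.zero_mem_of_neg_smul_recession hd ht ?_) h0
        rwa [← hxd, neg_neg]
      · rw [← hrec]
        exact ⟨hx', hnx'⟩
  · obtain ⟨c, hc⟩ := hne
    have hzero : (0 : E) ∈ closure {y : E | ∃ t : ℝ, 0 ≤ t ∧ ∃ c ∈ C, y = t • c} :=
      subset_closure ⟨0, le_rfl, c, hc, (zero_smul ℝ c).symm⟩
    rintro _ rfl
    exact ⟨hzero, by simpa using hzero⟩
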